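/- arXiv:1407.8299 — 2 statements merged into one kernel-verified Lean document; each statement's English description precedes it below -/
import Mathlib

section
/- Let φ : ℝ → ℂ be a Schwartz function and define Φ(y) := ∫_ℝ e^{iyξ} φ(ξ) dξ. Then for every x ∈ ℝ: (a) lim_{ε→0⁺} ∫_ℝ e^{ixξ} (ξ − iε)^{−1} φ(ξ) dξ = i ∫_{−∞}^{x} Φ(y) dy, and (b) lim_{ε→0⁺} ∫_ℝ e^{ixξ} (ξ + iε)^{−1} φ(ξ) dξ = −i ∫_{x}^{∞} Φ(y) dy. -/
open MeasureTheory Filter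

/-- The damped exponential `exp (ε (y - x)) exp (i y ξ)` integrates over `y ≤ x` to the
boundary kernel `(ξ - i ε)⁻¹ exp (i x ξ)`, up to a factor `i`. -/
lemma exp_mul_inv_sub_eq_integral_Iic {ε : ℝ} (hε : 0 < ε) (x ξ : ℝ) :
    Complex.exp (Complex.I * x * ξ) * ((ξ : ℂ) - Complex.I * ε)⁻¹ =
      Complex.I * ∫ y in Set.Iic x,
        (Real.exp (ε * (y - x)) : ℂ) * Complex.exp (Complex.I * y * ξ) := by
  have hre : 0 < (Complex.I * ξ + ε : ℂ).re := by simpa using hε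
  have hfactor : (ξ : ℂ) - Complex.I * ε = -Complex.I * (Complex.I * ξ + ε) := by
    linear_combination (ξ : ℂ) * Complex.I_sq
  have hexp (y : ℝ) : (Real.exp (ε * (y - x)) : ℂ) * Complex.exp (Complex.I * y * ξ) =
      Complex.exp (-(ε * x)) * Complex.exp ((Complex.I * ξ + ε) * y) := by
    push_cast
    rw [← Complex.exp_add, ← Complex.exp_add]
    ring_nf
  have hend : Complex.exp (-(ε * x)) * Complex.exp ((Complex.I * ξ + ε) * x) =
      Complex.exp (Complex.I * x * ξ) := by
    rw [← Complex.exp_add]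
    ring_nf
  simp_rw [hexp]
  rw [integral_const_mul, integral_exp_mul_complex_Iic hre, ← mul_div_assoc, hend, hfactor,
    mul_inv, inv_neg, Complex.inv_I, neg_neg]
  ring

/-- Fubini for the damped kernel. -/
lemma integral_exp_mul_inv_sub_mul_eq {f : ℝ → ℂ} (hf : Integrable f) {ε : ℝ} (hε : 0 < ε)
    (x : ℝ) :
    ∫ ξ : ℝ, Complex.exp (Complex.I * x * ξ) * ((ξ : ℂ) - Complex.I * ε)⁻¹ * f ξ =
      Complex.I * ∫ y in Set.Iic x, (Real.exp (ε * (y - x)) : ℂ) *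
        ∫ ξ : ℝ, Complex.exp (Complex.I * y * ξ) * f ξ := by
  have hdamp : IntegrableOn (fun y : ℝ => (Real.exp (ε * (y - x)) : ℂ)) (Set.Iic x) := by
    have h := (integrableOn_exp_mul_Iic hε x).const_mul (Real.exp (-(ε * x)))
    refine (h.congr (g := fun y => Real.exp (ε * (y - x))) (ae_of_all _ fun y => ?_)).ofReal
    simp only [← Real.exp_add]
    ring_nf
  have hprod : Integrable (Function.uncurry fun (ξ y : ℝ) =>
      (Real.exp (ε * (y - x)) : ℂ) * Complex.exp (Complex.I * y * ξ) * f ξ)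
      (volume.prod (volume.restrict (Set.Iic x))) := by
    have h := (hf.mul_prod hdamp).bdd_mul (c := 1)
      (f := fun p : ℝ × ℝ => Complex.exp (Complex.I * p.2 * p.1))
      (by fun_prop) (ae_of_all _ fun p => by simp [Complex.norm_exp])
    refine h.congr (ae_of_all _ fun p => ?_)
    simp only [Function.uncurry]
    ring
  simp_rw [exp_mul_inv_sub_eq_integral_Iic hε, mul_assoc Complex.I (integral _ _),
    ← integral_mul_const]
  rw [integral_const_mul, integral_integral_swap hprod]
  simp_rw [mul_assoc, integral_const_mul]

lemma tendsto_integral_exp_mul_inv_sub {f : ℝ → ℂ} (hf : Integrable f)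
    (hF : Integrable fun y : ℝ => ∫ ξ : ℝ, Complex.exp (Complex.I * y * ξ) * f ξ) (x : ℝ) :
    Tendsto
      (fun ε : ℝ => ∫ ξ : ℝ,
        Complex.exp (Complex.I * x * ξ) * ((ξ : ℂ) - Complex.I * ε)⁻¹ * f ξ)
      (nhdsWithin 0 (Set.Ioi 0))
      (nhds (Complex.I * ∫ y in Set.Iic x, ∫ ξ : ℝ,
        Complex.exp (Complex.I * y * ξ) * f ξ)) := by
  have hev : ∀ᶠ ε : ℝ in nhdsWithin 0 (Set.Ioi 0), 0 < ε := self_mem_nhdsWithin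
  refine Tendsto.congr' (hev.mono fun ε hε => (integral_exp_mul_inv_sub_mul_eq hf hε x).symm) ?_
  refine Tendsto.const_mul _ (tendsto_integral_filter_of_dominated_convergence _ ?_ ?_
    hF.norm.integrableOn ?_)
  · exact Eventually.of_forall fun ε =>
      AEStronglyMeasurable.mul (by fun_prop) hF.aestronglyMeasurable.restrict
  · filter_upwards [hev] with ε hε
    filter_upwards [ae_restrict_mem measurableSet_Iic] with y hy
    rw [norm_mul, Complex.norm_real, Real.norm_eq_abs, Real.abs_exp]
    refine mul_le_of_le_one_left (norm_nonneg _) (Real.exp_le_one_iff.2 ?_)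
    exact mul_nonpos_of_nonneg_of_nonpos hε.le (sub_nonpos.2 hy)
  · refine ae_of_all _ fun y => ?_
    have hcont : Continuous fun ε : ℝ => (Real.exp (ε * (y - x)) : ℂ) *
        ∫ ξ : ℝ, Complex.exp (Complex.I * y * ξ) * f ξ := by fun_prop
    simpa using (hcont.tendsto 0).mono_left nhdsWithin_le_nhds

lemma integral_exp_mul_comp_neg (f : ℝ → ℂ) (y : ℝ) :
    ∫ ξ : ℝ, Complex.exp (Complex.I * y * ξ) * f (-ξ) =
      ∫ ξ : ℝ, Complex.exp (Complex.I * (-y : ℝ) * ξ) * f ξ := by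
  rw [← integral_neg_eq_self]
  simp

lemma tendsto_integral_exp_mul_inv_add {f : ℝ → ℂ} (hf : Integrable f)
    (hF : Integrable fun y : ℝ => ∫ ξ : ℝ, Complex.exp (Complex.I * y * ξ) * f ξ) (x : ℝ) :
    Tendsto
      (fun ε : ℝ => ∫ ξ : ℝ,
        Complex.exp (Complex.I * x * ξ) * ((ξ : ℂ) + Complex.I * ε)⁻¹ * f ξ)
      (nhdsWithin 0 (Set.Ioi 0))
      (nhds (-Complex.I * ∫ y in Set.Ici x, ∫ ξ : ℝ,
        Complex.exp (Complex.I * y * ξ) * f ξ)) := by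
  have hF' : Integrable fun y : ℝ =>
      ∫ ξ : ℝ, Complex.exp (Complex.I * y * ξ) * f (-ξ) := by
    simp_rw [integral_exp_mul_comp_neg]
    exact hF.comp_neg
  have h := (tendsto_integral_exp_mul_inv_sub hf.comp_neg hF' (-x)).neg
  simp_rw [integral_exp_mul_comp_neg] at h
  rw [integral_comp_neg_Iic (-x)
    (fun y : ℝ => ∫ ξ : ℝ, Complex.exp (Complex.I * y * ξ) * f ξ), neg_neg,
    ← integral_Ici_eq_integral_Ioi, ← neg_mul] at h
  refine h.congr fun ε => ?_
  rw [← integral_neg, ← integral_neg_eq_self]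
  refine integral_congr_ae (ae_of_all _ fun ξ => ?_)
  have hinv : ((-ξ : ℝ) : ℂ) - Complex.I * ε = -((ξ : ℂ) + Complex.I * ε) := by
    push_cast
    ring
  simp only [hinv, inv_neg, neg_neg]
  simp

lemma SchwartzMap.integrable_integral_exp_mul (φ : SchwartzMap ℝ ℂ) :
    Integrable fun y : ℝ => ∫ ξ : ℝ, Complex.exp (Complex.I * y * ξ) * φ ξ := by
  have h := (FourierTransformInv.fourierInv φ : SchwartzMap ℝ ℂ).integrable
    (μ := volume) |>.comp_div (R := 2 * Real.pi) (by positivity)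
  refine h.congr (ae_of_all _ fun y => ?_)
  simp only [SchwartzMap.fourierInv_coe, Real.fourierInv_eq']
  refine integral_congr_ae (ae_of_all _ fun ξ => ?_)
  have hphase : 2 * Real.pi * (y / (2 * Real.pi) * ξ) = y * ξ := by
    field_simp
  simp only [RCLike.inner_apply, conj_trivial, smul_eq_mul, hphase]
  push_cast
  ring_nf

theorem stmt_7 (φ : SchwartzMap ℝ ℂ) (x : ℝ) :
    Tendsto
      (fun ε : ℝ => ∫ ξ : ℝ,
        Complex.exp (Complex.I * (x : ℂ) * (ξ : ℂ)) * ((ξ : ℂ) - Complex.I * (ε : ℂ))⁻¹ * φ ξ)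
      (nhdsWithin 0 (Set.Ioi 0))
      (nhds (Complex.I * ∫ y in Set.Iic x, ∫ ξ : ℝ,
        Complex.exp (Complex.I * (y : ℂ) * (ξ : ℂ)) * φ ξ)) ∧
    Tendsto
      (fun ε : ℝ => ∫ ξ : ℝ,
        Complex.exp (Complex.I * (x : ℂ) * (ξ : ℂ)) * ((ξ : ℂ) + Complex.I * (ε : ℂ))⁻¹ * φ ξ)
      (nhdsWithin 0 (Set.Ioi 0))
      (nhds (-Complex.I * ∫ y in Set.Ici x, ∫ ξ : ℝ,
        Complex.exp (Complex.I * (y : ℂ) * (ξ : ℂ)) * φ ξ)) :=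
  ⟨tendsto_integral_exp_mul_inv_sub φ.integrable φ.integrable_integral_exp_mul x,
    tendsto_integral_exp_mul_inv_add φ.integrable φ.integrable_integral_exp_mul x⟩
end

section
/- Define p : ℝ² → ℝ by p(ξ₁, ξ₂) = 3 − cos ξ₁ − cos ξ₂ − cos(ξ₁ + ξ₂). Then the gradient of p vanishes at (ξ₁, ξ₂), i.e., sin ξ₁ + sin(ξ₁ + ξ₂) = 0 and sin ξ₂ + sin(ξ₁ + ξ₂) = 0, if and only if, modulo 2π in each coordinate, either (1) ξ₁ ∈ {0, π} and ξ₂ ∈ {0, π}, or (2) ξ₁ = ξ₂ = 2π/3, or (3) ξ₁ = ξ₂ = −2π/3. -/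
open Real

theorem cos_eq_and_sin_eq_iff_exists_int (x a : ℝ) :
    (cos x = cos a ∧ sin x = sin a) ↔ ∃ k : ℤ, x = a + 2 * π * k := by
  constructor
  · rintro ⟨hc, hs⟩
    obtain ⟨k, hk⟩ := Real.Angle.angle_eq_iff_two_pi_dvd_sub.mp (Real.Angle.cos_sin_inj hc hs)
    exact ⟨k, by linarith⟩
  · rintro ⟨k, rfl⟩
    rw [mul_comm (2 * π)]
    exact ⟨cos_add_int_mul_two_pi a k, sin_add_int_mul_two_pi a k⟩

theorem sin_eq_zero_iff_exists_two_pi (x : ℝ) :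
    sin x = 0 ↔ ∃ k : ℤ, x = 2 * π * k ∨ x = π + 2 * π * k := by
  rw [sin_eq_zero_iff]
  constructor
  · rintro ⟨n, rfl⟩
    obtain ⟨k, rfl | rfl⟩ := Int.even_or_odd' n
    · exact ⟨k, Or.inl (by push_cast; ring)⟩
    · exact ⟨k, Or.inr (by push_cast; ring)⟩
  · rintro ⟨k, rfl | rfl⟩
    · exact ⟨2 * k, by push_cast; ring⟩
    · exact ⟨2 * k + 1, by push_cast; ring⟩

theorem cos_two_pi_div_three_eq : cos (2 * π / 3) = -(1 / 2) := by
  rw [show 2 * π / 3 = π - π / 3 by ring, cos_pi_sub, cos_pi_div_three]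

theorem sin_two_pi_div_three_eq : sin (2 * π / 3) = √3 / 2 := by
  rw [show 2 * π / 3 = π - π / 3 by ring, sin_pi_sub, sin_pi_div_three]

theorem stmt_16 (ξ₁ ξ₂ : ℝ) :
    (Real.sin ξ₁ + Real.sin (ξ₁ + ξ₂) = 0 ∧ Real.sin ξ₂ + Real.sin (ξ₁ + ξ₂) = 0) ↔
      (((∃ k : ℤ, ξ₁ = 2 * π * k ∨ ξ₁ = π + 2 * π * k) ∧
          (∃ k : ℤ, ξ₂ = 2 * π * k ∨ ξ₂ = π + 2 * π * k)) ∨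
        ((∃ k : ℤ, ξ₁ = 2 * π / 3 + 2 * π * k) ∧ (∃ k : ℤ, ξ₂ = 2 * π / 3 + 2 * π * k)) ∨
        ((∃ k : ℤ, ξ₁ = -(2 * π / 3) + 2 * π * k) ∧
          (∃ k : ℤ, ξ₂ = -(2 * π / 3) + 2 * π * k))) := by
  rw [← sin_eq_zero_iff_exists_two_pi, ← sin_eq_zero_iff_exists_two_pi,
    ← cos_eq_and_sin_eq_iff_exists_int, ← cos_eq_and_sin_eq_iff_exists_int,
    ← cos_eq_and_sin_eq_iff_exists_int, ← cos_eq_and_sin_eq_iff_exists_int,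
    cos_neg, sin_neg, cos_two_pi_div_three_eq, sin_two_pi_div_three_eq, sin_add]
  constructor
  · rintro ⟨h₁, h₂⟩
    have hs : sin ξ₂ = sin ξ₁ := by linarith
    rw [hs] at h₁ ⊢
    by_cases h0 : sin ξ₁ = 0
    · exact Or.inl ⟨h0, h0⟩
    right
    have hsum : cos ξ₁ + cos ξ₂ = -1 := by
      apply mul_left_cancel₀ h0
      linarith
    have hsq₁ := sin_sq_add_cos_sq ξ₁
    have hsq₂ := sin_sq_add_cos_sq ξ₂
    rw [hs] at hsq₂
    have hdiff : cos ξ₁ = cos ξ₂ := by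
      linear_combination (cos ξ₁ - cos ξ₂) * hsum - hsq₁ + hsq₂
    have hc₁ : cos ξ₁ = -(1 / 2) := by linarith
    have hc₂ : cos ξ₂ = -(1 / 2) := by linarith
    have hsin : sin ξ₁ ^ 2 = (√3 / 2) ^ 2 := by
      rw [hc₁] at hsq₁
      rw [div_pow, sq_sqrt (by norm_num)]
      linarith
    rcases sq_eq_sq_iff_eq_or_eq_neg.mp hsin with h | h
    · exact Or.inl ⟨⟨hc₁, h⟩, hc₂, h⟩
    · exact Or.inr ⟨⟨hc₁, h⟩, hc₂, h⟩
  · rintro (⟨h₁, h₂⟩ | ⟨⟨hc₁, hs₁⟩, hc₂, hs₂⟩ | ⟨⟨hc₁, hs₁⟩, hc₂, hs₂⟩)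
    · simp [h₁, h₂]
    · rw [hc₁, hs₁, hc₂, hs₂]
      constructor <;> ring
    · rw [hc₁, hs₁, hc₂, hs₂]
      constructor <;> ring
end
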